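/- There exists a unique linear map Ψ : V → V such that for all 0 ≤ i ≤ d/2 and i ≤ j ≤ d−i, Ψ(R^{j−i} v) = (ϑ_j − ϑ_i) R^{j−i−1} v for all v ∈ K_i (interpreting R^{−1}v = 0 when j = i). This Ψ satisfies Ψ U_j ⊆ U_{j−1} for 1 ≤ j ≤ d and Ψ U_0 = 0. -/

import Mathlib

/-- In a modular lattice, an independent family dominating a family with supremum `⊤` equals it. -/
theorem iSupIndep.eq_of_le_of_iSup_eq_top {α ι : Type*} [CompleteLattice α] [IsModularLattice α]
    {s u : ι → α} (hu : iSupIndep u) (hle : ∀ i, s i ≤ u i) (htop : iSup s = ⊤) : s = u := by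
  funext i
  symm
  have hcover : s i ⊔ ⨆ k, ⨆ (_ : k ≠ i), u k = ⊤ := by
    refine top_le_iff.mp (htop ▸ iSup_le fun k => ?_)
    rcases eq_or_ne k i with rfl | hk
    · exact le_sup_left
    · exact le_sup_of_le_right ((hle k).trans (le_iSup₂_of_le k hk le_rfl))
  calc u i = (s i ⊔ ⨆ k, ⨆ (_ : k ≠ i), u k) ⊓ u i := by rw [hcover, top_inf_eq]
    _ = s i ⊔ (⨆ k, ⨆ (_ : k ≠ i), u k) ⊓ u i := sup_inf_assoc_of_le _ (hle i)
    _ = s i := by rw [(hu i).symm.eq_bot, sup_bot_eq]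

/-- Linear maps prescribed on the summands of an internal direct sum glue to a linear map. -/
theorem iSupIndep.exists_linearMap_eqOn {ι A M N : Type*} [Ring A] [AddCommGroup M] [Module A M]
    [AddCommGroup N] [Module A N] {W : ι → Submodule A M} (hind : iSupIndep W)
    (htop : iSup W = ⊤) (f : ι → M →ₗ[A] N) :
    ∃ F : M →ₗ[A] N, ∀ p, ∀ w ∈ W p, F w = f p w := by
  classical
  have hint : DirectSum.IsInternal W :=
    DirectSum.isInternal_submodule_of_iSupIndep_of_iSup_eq_top hind htop
  let e := LinearEquiv.ofBijective (DirectSum.coeLinearMap W) hint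
  refine ⟨DirectSum.toModule A ι N (fun p => f p ∘ₗ (W p).subtype) ∘ₗ e.symm.toLinearMap,
    fun p w hw => ?_⟩
  have he : e.symm w = DirectSum.lof A ι (fun p => W p) p ⟨w, hw⟩ := by
    rw [LinearEquiv.symm_apply_eq]
    exact (DirectSum.coeLinearMap_lof W p ⟨w, hw⟩).symm
  simp [he]

/-- A linear map injective on a subspace has a linear left inverse there. -/
theorem LinearMap.exists_leftInverse_on {K V W : Type*} [Field K] [AddCommGroup V] [Module K V]
    [AddCommGroup W] [Module K W] (f : V →ₗ[K] W) (P : Submodule K V)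
    (hf : ∀ x ∈ P, f x = 0 → x = 0) : ∃ g : W →ₗ[K] V, ∀ x ∈ P, g (f x) = x := by
  have hker : LinearMap.ker (f.domRestrict P) = ⊥ := by
    rw [LinearMap.ker_eq_bot']
    rintro ⟨x, hx⟩ h
    exact Subtype.ext (hf x hx h)
  obtain ⟨g, hg⟩ := (f.domRestrict P).exists_leftInverse_of_injective hker
  exact ⟨P.subtype ∘ₗ g, fun x hx => congrArg Subtype.val (LinearMap.congr_fun hg ⟨x, hx⟩)⟩


theorem stmt18 {K V : Type*} [Field K] [AddCommGroup V] [Module K V]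
    [FiniteDimensional K V] (d : ℕ)
    (U : ℕ → Submodule K V)
    (hUbot : ∀ i, d < i → U i = ⊥)
    (hUtop : iSup U = ⊤)
    (hUind : iSupIndep U)
    (R : Module.End K V)
    (hR : ∀ i < d, Submodule.map R (U i) ≤ U (i + 1))
    (hRd : Submodule.map R (U d) = ⊥)
    (hinj : ∀ i j, i ≤ j → j ≤ d → i + j ≤ d →
      ∀ x ∈ U i, (R ^ (j - i)) x = 0 → x = 0)
    (hsurj : ∀ i j, i ≤ j → j ≤ d → d ≤ i + j →
      ∀ y ∈ U j, ∃ x ∈ U i, (R ^ (j - i)) x = y)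
    (Kk : ℕ → Submodule K V)
    (hK : ∀ i, 2 * i ≤ d → Kk i = U i ⊓ LinearMap.ker (R ^ (d - 2 * i + 1)))
    (hrefine_top : (⨆ i, ⨆ (_ : 2 * i ≤ d), ⨆ j ∈ Finset.Icc i (d - i),
      Submodule.map (R ^ (j - i)) (Kk i)) = ⊤)
    (hrefine_ind : iSupIndep
      (fun p : {p : ℕ × ℕ // 2 * p.1 ≤ d ∧ p.1 ≤ p.2 ∧ p.2 ≤ d - p.1} =>
        Submodule.map (R ^ (p.1.2 - p.1.1)) (Kk p.1.1)))
    (ϑ : ℕ → K) :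
    (∃! Ψ : Module.End K V, ∀ i j, 2 * i ≤ d → i ≤ j → j ≤ d - i →
      ∀ v ∈ Kk i, Ψ ((R ^ (j - i)) v) = (ϑ j - ϑ i) • (R ^ (j - i - 1)) v) ∧
    (∀ Ψ : Module.End K V,
      (∀ i j, 2 * i ≤ d → i ≤ j → j ≤ d - i →
        ∀ v ∈ Kk i, Ψ ((R ^ (j - i)) v) = (ϑ j - ϑ i) • (R ^ (j - i - 1)) v) →
      Submodule.map Ψ (U 0) = ⊥ ∧
      ∀ j, 1 ≤ j → j ≤ d → Submodule.map Ψ (U j) ≤ U (j - 1)) := by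
  have hpow : ∀ i n, i + n ≤ d → ∀ v ∈ U i, (R ^ n) v ∈ U (i + n) := by
    intro i n
    induction n with
    | zero => intro _ v hv; simpa using hv
    | succ n ih =>
      intro hn v hv
      rw [pow_succ', Module.End.mul_apply]
      exact hR (i + n) (by omega) (Submodule.mem_map_of_mem (ih (by omega) v hv))
  have hKU : ∀ i, 2 * i ≤ d → Kk i ≤ U i := fun i hi => (hK i hi).trans_le inf_le_left
  let ι := {p : ℕ × ℕ // 2 * p.1 ≤ d ∧ p.1 ≤ p.2 ∧ p.2 ≤ d - p.1}
  let W : ι → Submodule K V := fun p => Submodule.map (R ^ (p.1.2 - p.1.1)) (Kk p.1.1)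
  have hWtop : iSup W = ⊤ := by
    refine top_le_iff.mp (hrefine_top ▸ ?_)
    refine iSup_le fun i => iSup_le fun hi => iSup₂_le fun j hj => ?_
    rw [Finset.mem_Icc] at hj
    exact le_iSup W ⟨(i, j), hi, hj.1, hj.2⟩
  refine ⟨?_, fun Ψ hΨ => ?_⟩
  · have hleft : ∀ p : ι, ∃ g : V →ₗ[K] V,
        ∀ x ∈ Kk p.1.1, g ((R ^ (p.1.2 - p.1.1)) x) = x := by
      rintro ⟨⟨i, j⟩, hi, hij, hj⟩
      dsimp only at hi hij hj
      exact LinearMap.exists_leftInverse_on _ _ fun x hx =>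
        hinj i j hij (by omega) (by omega) x (hKU i hi hx)
    choose g hg using hleft
    obtain ⟨Ψ, hΨ⟩ := iSupIndep.exists_linearMap_eqOn (W := W) hrefine_ind hWtop
      (fun p => (ϑ p.1.2 - ϑ p.1.1) • ((R ^ (p.1.2 - p.1.1 - 1)) ∘ₗ g p))
    refine ⟨Ψ, fun i j hi hij hj v hv => ?_, fun Φ hΦ => ?_⟩
    · rw [hΨ ⟨(i, j), hi, hij, hj⟩ _ (Submodule.mem_map_of_mem hv)]
      simp [hg ⟨(i, j), hi, hij, hj⟩ v hv]
    · have hle : iSup W ≤ LinearMap.eqLocus Φ Ψ := by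
        refine iSup_le ?_
        rintro ⟨⟨i, j⟩, hi, hij, hj⟩ _ ⟨v, hv, rfl⟩
        rw [LinearMap.mem_eqLocus, hΦ i j hi hij hj v hv,
          hΨ ⟨(i, j), hi, hij, hj⟩ _ (Submodule.mem_map_of_mem hv)]
        simp [hg ⟨(i, j), hi, hij, hj⟩ v hv]
      exact LinearMap.ext fun x => hle (hWtop ▸ Submodule.mem_top)
  · let S : ℕ → Submodule K V := fun j => ⨆ p : ι, ⨆ (_ : p.1.2 = j), W p
    have hSU : S = U := by
      refine hUind.eq_of_le_of_iSup_eq_top (fun j => ?_) ?_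
      · refine iSup₂_le ?_
        rintro ⟨⟨i, j⟩, hi, hij, hj⟩ rfl _ ⟨v, hv, rfl⟩
        dsimp only at hi hij hj ⊢
        have := hpow i (j - i) (by omega) v (hKU i hi hv)
        rwa [Nat.add_sub_cancel' hij] at this
      · refine top_le_iff.mp (hWtop ▸ iSup_le fun p => ?_)
        exact le_iSup_of_le p.1.2 (le_iSup₂_of_le p rfl le_rfl)
    have hmap : ∀ (j : ℕ) (T : Submodule K V),
        (∀ i, 2 * i ≤ d → i ≤ j → j ≤ d - i → ∀ v ∈ Kk i,
          (ϑ j - ϑ i) • (R ^ (j - i - 1)) v ∈ T) → Submodule.map Ψ (U j) ≤ T := by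
      intro j T hT
      rw [← hSU, Submodule.map_le_iff_le_comap]
      refine iSup₂_le ?_
      rintro ⟨⟨i, j⟩, hi, hij, hj⟩ rfl _ ⟨v, hv, rfl⟩
      rw [Submodule.mem_comap, hΨ i j hi hij hj v hv]
      exact hT i hi hij hj v hv
    refine ⟨le_bot_iff.mp (hmap 0 ⊥ fun i _ hi _ v _ => ?_),
      fun j _ _ => hmap j _ fun i hi hij hj v hv => ?_⟩
    · simp [Nat.le_zero.mp hi]
    · rcases hij.eq_or_lt with rfl | hlt
      · simp
      · refine Submodule.smul_mem _ _ ?_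
        have := hpow i (j - i - 1) (by omega) v (hKU i hi hv)
        rwa [show i + (j - i - 1) = j - 1 by omega] at this
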